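/- Fix k ≥ 3 and c ∈ (0,1). There exists a constant C > 0 such that for all n and d with k - 1 ≤ d, d² ≤ n, n·d even, and d + 2 ≤ (1-c)·n: |log|G_{d,c,k}(n)| - (1 - c·(d-1)/(d+1))·(d·n/2)·log n| ≤ C·d·n·(1 + log d). -/

import Mathlib

/-- The number of `k`-cliques (sets of `k` mutually adjacent vertices) in a graph. -/
noncomputable def cliqueCount {V : Type*} (G : SimpleGraph V) (k : ℕ) : ℕ :=
  Nat.card {t : Finset V // G.IsNClique k t}

/-- A graph is `d`-regular: every vertex has degree exactly `d`. -/
def IsDRegular {V : Type*} (G : SimpleGraph V) (d : ℕ) : Prop :=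
  ∀ v : V, (G.neighborSet v).ncard = d

/-- `G_{d,c,k}(n)`: the set of simple `d`-regular graphs on the labeled vertex set `Fin n`
with at least `c * choose d (k-1) * n / k` `k`-cliques. -/
noncomputable def Gdck (n d : ℕ) (c : ℝ) (k : ℕ) : Set (SimpleGraph (Fin n)) :=
  {G | IsDRegular G d ∧ c * ((d.choose (k - 1) : ℝ) * n / k) ≤ (cliqueCount G k : ℝ)}

section UpperBound

open Finset

section Encoding

open scoped Classical in
theorem IsDRegular.card_filter_adj {V : Type*} [Fintype V] {G : SimpleGraph V}
    {d : ℕ} (hG : IsDRegular G d) (v : V) :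
    #{w | G.Adj v w} = d := by
  rw [← hG v, ← Set.ncard_coe_finset]
  congr 1
  ext w
  simp

theorem card_filter_powerset_card_le {V : Type*} [DecidableEq V] (B : Finset V) {b d : ℕ}
    (hB : #B ≤ b) : #{A ∈ B.powerset | #A ≤ d} ≤ (b + 1) ^ d := by
  have hsub : ({A ∈ B.powerset | #A ≤ d} : Finset (Finset V)) ⊆
      (range (d + 1)).biUnion fun j => B.powersetCard j := by
    intro A hA
    simp only [mem_filter, mem_powerset, mem_biUnion, mem_range, mem_powersetCard] at hA ⊢
    exact ⟨#A, by omega, hA.1, rfl⟩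
  refine (card_le_card hsub).trans (card_biUnion_le.trans ?_)
  rw [add_pow]
  refine sum_le_sum fun j hj => ?_
  rw [card_powersetCard, one_pow, mul_one]
  have h1 : 1 ≤ d.choose j := Nat.choose_pos (by simpa [Nat.lt_succ_iff] using hj)
  calc (#B).choose j ≤ b.choose j := Nat.choose_le_choose j hB
    _ ≤ b ^ j := Nat.choose_le_pow b j
    _ ≤ b ^ j * d.choose j := Nat.le_mul_of_pos_right _ h1

theorem exists_encode_subsets {V : Type*} [DecidableEq V] (B : Finset V) {b d : ℕ}
    (hB : #B ≤ b) : ∃ f : Finset V → Fin ((b + 1) ^ d), Set.InjOn f {A | A ⊆ B ∧ #A ≤ d} := by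
  have hcard : #{A ∈ B.powerset | #A ≤ d} ≤ #(univ : Finset (Fin ((b + 1) ^ d))) := by
    simpa using card_filter_powerset_card_le B hB
  rw [card_fin] at hcard
  refine ⟨fun A => if h : A ∈ B.powerset.filter (#· ≤ d) then
    Fin.castLE hcard (equivFin _ ⟨A, h⟩) else ⟨0, by positivity⟩, fun A hA A' hA' h => ?_⟩
  have hA₁ : A ∈ B.powerset.filter (#· ≤ d) := by simpa using hA
  have hA₂ : A' ∈ B.powerset.filter (#· ≤ d) := by simpa using hA'
  simpa only [hA₁, hA₂, dif_pos, Fin.castLE_inj, EmbeddingLike.apply_eq_iff_eq,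
    Subtype.mk.injEq] using h

variable {V : Type*} [Fintype V] [LinearOrder V]

open scoped Classical in
/-- The neighbours of `u` that come after `u` in the order given by `ρ`. -/
noncomputable def laterNeighbors (G : SimpleGraph V) (ρ : Equiv.Perm V) (u : V) : Finset V :=
  {v | ρ u < ρ v ∧ G.Adj u v}

open scoped Classical in
/-- The vertices that share with `u` a neighbour preceding `u` in the order given by `ρ`. -/
noncomputable def closable (G : SimpleGraph V) (ρ : Equiv.Perm V) (u : V) : Finset V :=
  {v | ∃ w, ρ w < ρ u ∧ G.Adj w u ∧ G.Adj w v}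

theorem IsDRegular.card_laterNeighbors_le {G : SimpleGraph V} {d : ℕ} (hG : IsDRegular G d)
    (ρ : Equiv.Perm V) (u : V) : #(laterNeighbors G ρ u) ≤ d := by
  classical
  rw [← hG.card_filter_adj u]
  refine card_le_card fun v hv => ?_
  simp only [laterNeighbors, mem_filter_univ] at hv ⊢
  exact hv.2

theorem IsDRegular.card_closable_le {G : SimpleGraph V} {d : ℕ} (hG : IsDRegular G d)
    (ρ : Equiv.Perm V) (u : V) : #(closable G ρ u) ≤ d ^ 2 := by
  classical
  have hsub : closable G ρ u ⊆ ({w | G.Adj u w} : Finset V).biUnion fun w => {v | G.Adj w v} := by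
    intro v hv
    simp only [closable, mem_filter_univ, mem_biUnion] at hv ⊢
    obtain ⟨w, -, hwu, hwv⟩ := hv
    exact ⟨w, hwu.symm, hwv⟩
  refine (card_le_card hsub).trans ?_
  refine (card_biUnion_le_card_mul _ _ d fun w _ => (hG.card_filter_adj w).le).trans ?_
  rw [hG.card_filter_adj u, sq]

theorem eq_of_laterNeighbors_eq {G H : SimpleGraph V} (ρ : Equiv.Perm V)
    (hout : ∀ u, laterNeighbors G ρ u \ closable G ρ u = laterNeighbors H ρ u \ closable H ρ u)
    (hin : ∀ u, closable G ρ u = closable H ρ u →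
      laterNeighbors G ρ u ∩ closable G ρ u = laterNeighbors H ρ u ∩ closable H ρ u) :
    G = H := by
  have key : ∀ x u, ρ u = x → ∀ v, G.Adj u v ↔ H.Adj u v := by
    intro x
    induction x using WellFoundedLT.induction with
    | _ x ih =>
      rintro u rfl v
      rcases lt_trichotomy (ρ v) (ρ u) with h | h | h
      · rw [G.adj_comm, H.adj_comm]
        exact ih _ h v rfl u
      · rw [ρ.injective h]
        simp
      · have hcl : closable G ρ u = closable H ρ u := by
          ext v
          simp only [closable, mem_filter_univ]
          refine exists_congr fun w => and_congr_right fun hw => ?_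
          rw [ih _ hw w rfl u, ih _ hw w rfl v]
        have hl : laterNeighbors G ρ u = laterNeighbors H ρ u := by
          rw [← sdiff_union_inter (laterNeighbors G ρ u) (closable G ρ u), hout u, hin u hcl,
            sdiff_union_inter]
        have hv := congrArg (v ∈ ·) hl
        simpa [laterNeighbors, h] using hv
  ext u v
  exact key _ u rfl v

/-- Each edge that closes no triangle with an earlier vertex is paid for with a factor `x`; the
resulting weighted number of `d`-regular graphs is small, since all other edges are found among few
candidates. -/
theorem sum_pow_card_sdiff_closable_le {d : ℕ} (R : Finset (SimpleGraph V))
    (hR : ∀ G ∈ R, IsDRegular G d) (ρ : Equiv.Perm V) {x : ℝ} (hx : 0 ≤ x) :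
    ∑ G ∈ R, ∏ u, x ^ #(laterNeighbors G ρ u \ closable G ρ u) ≤
      (((d : ℝ) ^ 2 + 1) ^ d * (x + 1) ^ Fintype.card V) ^ Fintype.card V := by
  classical
  have henc : ∀ B : Finset V, ∃ f : Finset V → Fin ((d ^ 2 + 1) ^ d),
      #B ≤ d ^ 2 → Set.InjOn f {A | A ⊆ B ∧ #A ≤ d} := by
    intro B
    by_cases hB : #B ≤ d ^ 2
    · obtain ⟨f, hf⟩ := exists_encode_subsets (d := d) B hB
      exact ⟨f, fun _ => hf⟩
    · exact ⟨fun _ => ⟨0, by positivity⟩, fun h => absurd h hB⟩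
  choose enc henc using henc
  let code : SimpleGraph V → V → Finset V × Fin ((d ^ 2 + 1) ^ d) := fun G u =>
    (laterNeighbors G ρ u \ closable G ρ u,
      enc (closable G ρ u) (laterNeighbors G ρ u ∩ closable G ρ u))
  have hinj : Set.InjOn code R := by
    intro G hG H hH h
    have h' := fun u => Prod.ext_iff.1 (congrFun h u)
    refine eq_of_laterNeighbors_eq ρ (fun u => (h' u).1) fun u hcl => ?_
    have h2 := (h' u).2
    simp only [code, hcl] at h2
    rw [hcl]
    refine henc _ ((hR H hH).card_closable_le ρ u) ⟨inter_subset_right, ?_⟩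
      ⟨inter_subset_right, ?_⟩ h2
    · exact (card_le_card inter_subset_left).trans ((hR G hG).card_laterNeighbors_le ρ u)
    · exact (card_le_card inter_subset_left).trans ((hR H hH).card_laterNeighbors_le ρ u)
  calc ∑ G ∈ R, ∏ u, x ^ #(laterNeighbors G ρ u \ closable G ρ u)
      = ∑ g ∈ R.image code, ∏ u, x ^ #(g u).1 := by
        rw [sum_image hinj]
    _ ≤ ∑ g : V → Finset V × Fin ((d ^ 2 + 1) ^ d), ∏ u, x ^ #(g u).1 :=
        sum_le_sum_of_subset_of_nonneg (subset_univ _) fun g _ _ =>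
          prod_nonneg fun u _ => pow_nonneg hx _
    _ = (∑ p : Finset V × Fin ((d ^ 2 + 1) ^ d), x ^ #p.1) ^ Fintype.card V := by
        rw [← card_univ (α := V), ← prod_const, prod_univ_sum, Fintype.piFinset_univ]
    _ = (((d : ℝ) ^ 2 + 1) ^ d * (x + 1) ^ Fintype.card V) ^ Fintype.card V := by
        congr 1
        rw [Fintype.sum_prod_type, ← Fintype.sum_pow_mul_eq_add_pow V x 1]
        simp [mul_sum]

end Encoding

section Averaging

variable {V : Type*} [Fintype V] [LinearOrder V]

theorem card_mul_card_perm_min (A : Finset V) {a : V} (ha : a ∈ A) :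
    #A * #{ρ : Equiv.Perm V | ∀ x ∈ A, ρ a ≤ ρ x} = (Fintype.card V).factorial := by
  have hsymm : ∀ b ∈ A, #{ρ : Equiv.Perm V | ∀ x ∈ A, ρ b ≤ ρ x} =
      #{ρ : Equiv.Perm V | ∀ x ∈ A, ρ a ≤ ρ x} := by
    intro b hb
    have hswap : ∀ x ∈ A, Equiv.swap a b x ∈ A := by
      intro x hx
      rw [Equiv.swap_apply_def]
      split_ifs <;> assumption
    refine card_bij' (fun ρ _ => ρ * Equiv.swap a b) (fun ρ _ => ρ * Equiv.swap a b) ?_ ?_ ?_ ?_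
    · intro ρ hρ
      simp only [mem_filter_univ, Equiv.Perm.mul_apply, Equiv.swap_apply_left] at hρ ⊢
      exact fun x hx => hρ _ (hswap x hx)
    · intro ρ hρ
      simp only [mem_filter_univ, Equiv.Perm.mul_apply, Equiv.swap_apply_right] at hρ ⊢
      exact fun x hx => hρ _ (hswap x hx)
    · intro ρ _
      simp [mul_assoc]
    · intro ρ _
      simp [mul_assoc]
  have hcover : A.biUnion (fun b => {ρ : Equiv.Perm V | ∀ x ∈ A, ρ b ≤ ρ x}) = univ := by
    refine eq_univ_of_forall fun ρ => ?_
    obtain ⟨b, hb, hmin⟩ := exists_min_image A ρ ⟨a, ha⟩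
    exact mem_biUnion.2 ⟨b, hb, by simpa using hmin⟩
  have hdisj : (A : Set V).PairwiseDisjoint
      fun b => ({ρ : Equiv.Perm V | ∀ x ∈ A, ρ b ≤ ρ x} : Finset (Equiv.Perm V)) := by
    intro b hb b' hb' hne
    refine disjoint_left.2 fun ρ h h' => hne (ρ.injective ?_)
    simp only [mem_filter_univ] at h h'
    exact le_antisymm (h b' hb') (h' b hb)
  rw [← Fintype.card_perm, ← card_univ (α := Equiv.Perm V), ← congrArg card hcover,
    card_biUnion hdisj, sum_congr rfl hsymm, sum_const, smul_eq_mul]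

open scoped Classical in
/-- The number of common neighbours of `a` and `b`. -/
noncomputable def codegree {V : Type*} [Fintype V] (G : SimpleGraph V) (a b : V) : ℕ :=
  #{w | G.Adj a w ∧ G.Adj b w}

theorem IsDRegular.codegree_lt {V : Type*} [Fintype V] {G : SimpleGraph V} {d : ℕ}
    (hG : IsDRegular G d) {a b : V} (hab : G.Adj a b) : codegree G a b < d := by
  classical
  rw [← hG.card_filter_adj a]
  refine card_lt_card (ssubset_iff_of_subset ?_ |>.2 ⟨b, ?_, ?_⟩)
  · intro w hw
    simp only [mem_filter_univ] at hw ⊢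
    exact hw.1
  · simpa using hab
  · simp

theorem card_perm_mem_sdiff_closable_le {G : SimpleGraph V} {a b : V} (hab : G.Adj a b) :
    (codegree G a b + 2) * #{ρ : Equiv.Perm V | b ∈ laterNeighbors G ρ a \ closable G ρ a} ≤
      (Fintype.card V).factorial := by
  classical
  have hA : #(insert a (insert b ({w | G.Adj a w ∧ G.Adj b w} : Finset V))) =
      codegree G a b + 2 := by
    rw [card_insert_of_notMem, card_insert_of_notMem, codegree]
    · simp
    · simp [hab.ne]
  rw [← hA, ← card_mul_card_perm_min _ (mem_insert_self a _)]
  refine Nat.mul_le_mul_left _ (card_le_card fun ρ hρ => ?_)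
  simp only [mem_filter_univ, mem_sdiff, laterNeighbors, closable, not_exists, not_and] at hρ
  simp only [mem_filter_univ, mem_insert, forall_eq_or_imp]
  refine ⟨le_rfl, hρ.1.1.le, fun x hx => le_of_not_gt fun hlt => ?_⟩
  exact hρ.2 x hlt hx.1.symm hx.2.symm

open scoped Classical in
/-- The number of ordered triples of mutually adjacent vertices. -/
noncomputable def orderedTriangles {V : Type*} [Fintype V] (G : SimpleGraph V) : ℕ :=
  ∑ a, ∑ b with G.Adj a b, codegree G a b

theorem sum_perm_card_sdiff_closable_le {G : SimpleGraph V} {d : ℕ} (hG : IsDRegular G d) :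
    (∑ ρ : Equiv.Perm V, ∑ u, (#(laterNeighbors G ρ u \ closable G ρ u) : ℝ)) ≤
      Fintype.card (Equiv.Perm V) *
        (((d : ℝ) * Fintype.card V - orderedTriangles G / (d + 1)) / 2) := by
  classical
  have hswap : ∑ ρ : Equiv.Perm V, ∑ u, #(laterNeighbors G ρ u \ closable G ρ u) =
      ∑ a, ∑ b with G.Adj a b,
        #{ρ : Equiv.Perm V | b ∈ laterNeighbors G ρ a \ closable G ρ a} := by
    rw [sum_comm]
    refine sum_congr rfl fun a _ => ?_
    refine Eq.trans ?_ (sum_card_bipartiteAbove_eq_sum_card_bipartiteBelow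
      (fun (ρ : Equiv.Perm V) b => b ∈ laterNeighbors G ρ a \ closable G ρ a))
    refine sum_congr rfl fun ρ _ => congrArg card ?_
    ext b
    simp [bipartiteAbove, laterNeighbors]
    tauto
  have hterm : ∀ a, ∀ b ∈ ({b | G.Adj a b} : Finset V),
      (#{ρ : Equiv.Perm V | b ∈ laterNeighbors G ρ a \ closable G ρ a} : ℝ) ≤
        Fintype.card (Equiv.Perm V) * ((1 - (codegree G a b : ℝ) / (d + 1)) / 2) := by
    intro a b hb
    have hab : G.Adj a b := by simpa using hb
    have h1 : ((codegree G a b : ℝ) + 2) *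
        #{ρ : Equiv.Perm V | b ∈ laterNeighbors G ρ a \ closable G ρ a} ≤
        Fintype.card (Equiv.Perm V) := by
      rw [Fintype.card_perm]
      exact_mod_cast card_perm_mem_sdiff_closable_le hab
    have h2 : (codegree G a b : ℝ) + 1 ≤ d := by exact_mod_cast hG.codegree_lt hab
    set t : ℝ := (codegree G a b : ℝ) with ht
    have ht0 : 0 ≤ t := by positivity
    rw [← le_div_iff₀' (by positivity)] at h1
    refine h1.trans ?_
    rw [div_eq_mul_inv]
    refine mul_le_mul_of_nonneg_left ?_ (by positivity)
    rw [inv_eq_one_div, div_le_div_iff₀ (by positivity) two_pos, one_mul]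
    have h3 : t / (d + 1) * (t + 2) ≤ t := by
      rw [div_mul_eq_mul_div, div_le_iff₀ (by positivity)]
      exact mul_le_mul_of_nonneg_left (by linarith) ht0
    linarith
  calc (∑ ρ : Equiv.Perm V, ∑ u, (#(laterNeighbors G ρ u \ closable G ρ u) : ℝ))
      = ∑ a, ∑ b with G.Adj a b,
        (#{ρ : Equiv.Perm V | b ∈ laterNeighbors G ρ a \ closable G ρ a} : ℝ) := by
        exact_mod_cast hswap
    _ ≤ ∑ a, ∑ b with G.Adj a b,
        Fintype.card (Equiv.Perm V) * ((1 - (codegree G a b : ℝ) / (d + 1)) / 2) :=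
        sum_le_sum fun a _ => sum_le_sum (hterm a)
    _ = _ := by
        simp only [← mul_sum, ← sum_div, sum_sub_distrib, sum_const, hG.card_filter_adj,
          orderedTriangles, nsmul_eq_mul, mul_one, card_univ]
        push_cast
        ring

theorem card_mul_exp_neg_le_sum {ι : Type*} [Fintype ι] {p : ι → ℝ} {s L : ℝ} (hL : 0 ≤ L)
    (hp : ∑ i, p i ≤ Fintype.card ι * s) :
    Fintype.card ι * Real.exp (-(L * s)) ≤ ∑ i, Real.exp (-(L * p i)) := by
  have htangent : ∀ i, Real.exp (-(L * s)) * (1 - L * (p i - s)) ≤ Real.exp (-(L * p i)) := by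
    intro i
    have h : -(L * p i) = -(L * s) + -(L * (p i - s)) := by ring
    rw [h, Real.exp_add]
    refine mul_le_mul_of_nonneg_left ?_ (Real.exp_pos _).le
    linarith [Real.add_one_le_exp (-(L * (p i - s)))]
  refine le_trans ?_ (sum_le_sum fun i _ => htangent i)
  rw [← mul_sum, mul_comm]
  refine mul_le_mul_of_nonneg_left ?_ (Real.exp_pos _).le
  rw [sum_sub_distrib, ← mul_sum, sum_sub_distrib]
  simp only [sum_const, card_univ, nsmul_eq_mul, mul_one]
  nlinarith [mul_nonneg hL (sub_nonneg.2 hp)]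

/-- A family of `d`-regular graphs with at least `q` ordered triangles each is small. -/
theorem log_card_le_of_orderedTriangles {d : ℕ} [Nonempty V] (R : Finset (SimpleGraph V))
    (hR : ∀ G ∈ R, IsDRegular G d) {q : ℝ} (hq : ∀ G ∈ R, q ≤ orderedTriangles G)
    (hne : R.Nonempty) :
    Real.log #R ≤ ((d : ℝ) * Fintype.card V - q / (d + 1)) / 2 * Real.log (Fintype.card V) +
      Fintype.card V * (d * Real.log ((d : ℝ) ^ 2 + 1) + 1) := by
  set n := Fintype.card V with hn
  have hn0 : 0 < n := Fintype.card_pos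
  have hn1 : (0 : ℝ) < n := by exact_mod_cast hn0
  set s : ℝ := ((d : ℝ) * n - q / (d + 1)) / 2 with hs
  set L : ℝ := Real.log n with hLdef
  have hL : 0 ≤ L := Real.log_natCast_nonneg n
  set N : ℝ := ((Fintype.card (Equiv.Perm V) : ℕ) : ℝ) with hN
  have hN0 : 0 < N := by
    rw [hN]
    exact_mod_cast Fintype.card_pos
  set B : ℝ := (((d : ℝ) ^ 2 + 1) ^ d * ((n : ℝ)⁻¹ + 1) ^ n) ^ n with hB
  have hB0 : 0 < B := by positivity
  have hlow : ∀ G ∈ R, N * Real.exp (-(L * s)) ≤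
      ∑ ρ : Equiv.Perm V, ∏ u, ((n : ℝ)⁻¹) ^ #(laterNeighbors G ρ u \ closable G ρ u) := by
    intro G hG
    have h := card_mul_exp_neg_le_sum (s := s) hL
      ((sum_perm_card_sdiff_closable_le (hR G hG)).trans ?_)
    · refine h.trans_eq (sum_congr rfl fun ρ _ => ?_)
      rw [mul_sum, ← sum_neg_distrib, Real.exp_sum]
      refine prod_congr rfl fun u _ => ?_
      rw [mul_comm, ← mul_neg, Real.exp_nat_mul, Real.exp_neg, Real.exp_log hn1]
    · refine mul_le_mul_of_nonneg_left ?_ (by positivity)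
      have := hq G hG
      rw [hs]
      gcongr
  have hmain : (#R : ℝ) * Real.exp (-(L * s)) ≤ B := by
    refine le_of_mul_le_mul_left ?_ hN0
    calc N * (#R * Real.exp (-(L * s))) = ∑ G ∈ R, N * Real.exp (-(L * s)) := by
          rw [sum_const, nsmul_eq_mul]
          ring
      _ ≤ ∑ G ∈ R, ∑ ρ : Equiv.Perm V,
            ∏ u, ((n : ℝ)⁻¹) ^ #(laterNeighbors G ρ u \ closable G ρ u) := sum_le_sum hlow
      _ = ∑ ρ : Equiv.Perm V, ∑ G ∈ R,
            ∏ u, ((n : ℝ)⁻¹) ^ #(laterNeighbors G ρ u \ closable G ρ u) := sum_comm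
      _ ≤ ∑ ρ : Equiv.Perm V, B := sum_le_sum fun ρ _ =>
          sum_pow_card_sdiff_closable_le R hR ρ (by positivity)
      _ = N * B := by rw [sum_const, nsmul_eq_mul, card_univ]
  have hR0 : (0 : ℝ) < #R := by exact_mod_cast hne.card_pos
  have hlog := Real.log_le_log (by positivity) hmain
  rw [Real.log_mul hR0.ne' (Real.exp_pos _).ne', Real.log_exp, hB, Real.log_pow,
    Real.log_mul (by positivity) (by positivity), Real.log_pow, Real.log_pow] at hlog
  have h1 : Real.log ((n : ℝ)⁻¹ + 1) ≤ (n : ℝ)⁻¹ := by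
    linarith [Real.log_le_sub_one_of_pos (show (0 : ℝ) < (n : ℝ)⁻¹ + 1 by positivity)]
  have h2 : (n : ℝ) * Real.log ((n : ℝ)⁻¹ + 1) ≤ 1 := by
    calc (n : ℝ) * Real.log ((n : ℝ)⁻¹ + 1) ≤ n * (n : ℝ)⁻¹ := by gcongr
      _ = 1 := mul_inv_cancel₀ hn1.ne'
  have h3 : (n : ℝ) * (d * Real.log ((d : ℝ) ^ 2 + 1) + n * Real.log ((n : ℝ)⁻¹ + 1)) ≤
      n * (d * Real.log ((d : ℝ) ^ 2 + 1) + 1) := by gcongr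
  linarith

end Averaging

section Triangles

variable {V : Type*} [Fintype V]

open scoped Classical in
theorem orderedTriangles_eq_card (G : SimpleGraph V) :
    orderedTriangles G =
      #{p : V × V × V | G.Adj p.1 p.2.1 ∧ G.Adj p.1 p.2.2 ∧ G.Adj p.2.1 p.2.2} := by
  simp only [orderedTriangles, codegree, card_filter, sum_filter, Fintype.sum_prod_type, ite_and,
    sum_ite_irrel, sum_const_zero]

theorem IsDRegular.cliqueCount_mul_descFactorial_le {G : SimpleGraph V} {d : ℕ}
    (hG : IsDRegular G d) (j : ℕ) :
    cliqueCount G (j + 3) * (j + 3).descFactorial 3 ≤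
      orderedTriangles G * (d - 2).choose j := by
  classical
  rw [cliqueCount, Nat.card_eq_fintype_card, Fintype.card_subtype, orderedTriangles_eq_card]
  refine card_mul_le_card_mul
    (fun (t : Finset V) (p : V × V × V) => p.1 ∈ t ∧ p.2.1 ∈ t ∧ p.2.2 ∈ t) ?_ ?_
  · intro t ht
    have ht : G.IsNClique (j + 3) t := by simpa using ht
    have hcard : Fintype.card (Fin 3 ↪ t) = (j + 3).descFactorial 3 := by
      rw [Fintype.card_embedding_eq, Fintype.card_coe, ht.card_eq, Fintype.card_fin]
    rw [← hcard, ← card_univ]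
    refine card_le_card_of_injOn (fun f => ((f 0 : V), (f 1 : V), (f 2 : V))) ?_ ?_
    · intro f _
      have hadj : ∀ x y : Fin 3, x ≠ y → G.Adj (f x) (f y) := fun x y hxy =>
        ht.isClique (f x).2 (f y).2 fun h => hxy (f.injective (Subtype.ext h))
      simp [bipartiteAbove, hadj]
    · intro f _ g _ h
      simp only [Prod.mk.injEq, Subtype.coe_inj] at h
      ext x
      fin_cases x
      · simp [h.1]
      · simp [h.2.1]
      · simp [h.2.2]
  · rintro ⟨a, b, w⟩ hp
    simp only [mem_filter_univ] at hp
    obtain ⟨hab, haw, hbw⟩ := hp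
    have hcommon : #(({x | G.Adj a x ∧ G.Adj b x} : Finset V).erase w) ≤ d - 2 := by
      rw [card_erase_of_mem (by simp [haw, hbw])]
      have := hG.codegree_lt hab
      rw [codegree] at this
      omega
    refine le_trans ?_ (Nat.choose_le_choose j hcommon)
    rw [← card_powersetCard]
    refine card_le_card_of_injOn (fun t => ((t.erase a).erase b).erase w) ?_ ?_
    · intro t ht
      simp only [bipartiteBelow, coe_filter, Set.mem_ofPred_eq, mem_filter_univ] at ht
      obtain ⟨ht, ha, hb, hw⟩ := ht
      simp only [mem_coe, mem_powersetCard]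
      refine ⟨fun x hx => ?_, ?_⟩
      · simp only [mem_erase] at hx
        simp only [mem_erase, mem_filter_univ]
        exact ⟨hx.1, ht.isClique ha hx.2.2.2 (Ne.symm hx.2.2.1),
          ht.isClique hb hx.2.2.2 (Ne.symm hx.2.1)⟩
      · rw [card_erase_of_mem (by simp [hbw.ne', haw.ne', hw]),
          card_erase_of_mem (by simp [hab.ne', hb]), card_erase_of_mem ha, ht.card_eq]
        rfl
    · intro t ht t' ht' h
      simp only [bipartiteBelow, coe_filter, Set.mem_ofPred_eq] at ht ht'
      ext x
      have hx := congrArg (x ∈ ·) h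
      simp only [mem_erase, eq_iff_iff] at hx
      by_cases hxa : x = a
      · subst hxa; tauto
      by_cases hxb : x = b
      · subst hxb; tauto
      by_cases hxw : x = w
      · subst hxw; tauto
      tauto

theorem choose_mul_descFactorial (e j : ℕ) :
    (e + 2).choose (j + 2) * ((j + 2) * (j + 1)) = (e + 2) * (e + 1) * e.choose j := by
  have h1 := Nat.add_one_mul_choose_eq (e + 1) (j + 1)
  have h2 := Nat.add_one_mul_choose_eq e j
  calc (e + 2).choose (j + 2) * ((j + 2) * (j + 1))
      = (e + 1 + 1).choose (j + 1 + 1) * (j + 1 + 1) * (j + 1) := by ring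
    _ = (e + 2) * ((e + 1).choose (j + 1) * (j + 1)) := by rw [← h1]; ring
    _ = (e + 2) * (e + 1) * e.choose j := by rw [← h2]; ring

/-- Many `k`-cliques force proportionally many triangles. -/
theorem IsDRegular.le_orderedTriangles {G : SimpleGraph V} {d k : ℕ} (hG : IsDRegular G d)
    (hk : 3 ≤ k) (hkd : k - 1 ≤ d) {c x : ℝ}
    (h : c * ((d.choose (k - 1) : ℝ) * x / k) ≤ cliqueCount G k) :
    c * x * d * (d - 1) ≤ orderedTriangles G := by
  obtain ⟨j, rfl⟩ := Nat.exists_eq_add_of_le' hk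
  obtain ⟨e, rfl⟩ := Nat.exists_eq_add_of_le' (show 2 ≤ d by omega)
  have hje : j ≤ e := by omega
  have hpos : (0 : ℝ) < e.choose j := by exact_mod_cast Nat.choose_pos hje
  have h1 : (cliqueCount G (j + 3) : ℝ) * ((j + 3) * ((j + 2) * (j + 1))) ≤
      orderedTriangles G * e.choose j := by
    have := hG.cliqueCount_mul_descFactorial_le j
    simp only [Nat.descFactorial, Nat.add_sub_cancel, Nat.sub_zero, mul_one] at this
    rw [show j + 3 - 2 = j + 1 by omega, show j + 3 - 1 = j + 2 by omega] at this
    calc (cliqueCount G (j + 3) : ℝ) * ((j + 3) * ((j + 2) * (j + 1)))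
        = cliqueCount G (j + 3) * ((j + 1) * ((j + 2) * (j + 3))) := by ring
      _ ≤ orderedTriangles G * e.choose j := by exact_mod_cast this
  have h2 : ((e + 2).choose (j + 2) : ℝ) * ((j + 2) * (j + 1)) =
      (e + 2) * (e + 1) * e.choose j := by exact_mod_cast choose_mul_descFactorial e j
  have hfac : (0 : ℝ) ≤ (j + 3) * ((j + 2) * (j + 1)) := by positivity
  have h3 := (mul_le_mul_of_nonneg_right h hfac).trans h1
  rw [show j + 3 - 1 = j + 2 by omega] at h3
  refine le_of_mul_le_mul_right (le_trans (le_of_eq ?_) h3) hpos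
  push_cast
  have hj : (j : ℝ) + 3 ≠ 0 := by positivity
  field_simp
  linear_combination (-(c * x)) * h2

end Triangles

theorem one_sub_mul_div_nonneg {c x : ℝ} (hc1 : c ≤ 1) (hx : 1 ≤ x) :
    0 ≤ 1 - c * (x - 1) / (x + 1) := by
  rw [sub_nonneg, div_le_one (by linarith)]
  nlinarith

theorem log_card_Gdck_le {n d k : ℕ} {c : ℝ} (hk : 3 ≤ k) (hc1 : c ≤ 1)
    (hkd : k - 1 ≤ d) :
    Real.log (Nat.card (Gdck n d c k)) ≤
      (1 - c * ((d : ℝ) - 1) / ((d : ℝ) + 1)) * ((d : ℝ) * n / 2) * Real.log n +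
        n * (d * Real.log ((d : ℝ) ^ 2 + 1) + 1) := by
  classical
  rw [Nat.card_eq_card_toFinset]
  have hd1 : (1 : ℝ) ≤ d := by exact_mod_cast (show 1 ≤ d by omega)
  have hlogd : 0 ≤ Real.log ((d : ℝ) ^ 2 + 1) := Real.log_nonneg (by nlinarith)
  rcases (Gdck n d c k).toFinset.eq_empty_or_nonempty with hempty | hne
  · rw [hempty, card_empty, Nat.cast_zero, Real.log_zero]
    have := one_sub_mul_div_nonneg hc1 hd1
    have := Real.log_natCast_nonneg n
    positivity
  rcases Nat.eq_zero_or_pos n with rfl | hn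
  · have hcard : #(Gdck 0 d c k).toFinset ≤ 1 :=
      card_le_one_of_subsingleton _
    have hcard' : (#(Gdck 0 d c k).toFinset : ℝ) ≤ 1 := by exact_mod_cast hcard
    simpa using Real.log_nonpos (by positivity) hcard'
  have : NeZero n := ⟨hn.ne'⟩
  have h := log_card_le_of_orderedTriangles (d := d) (q := c * n * d * (d - 1))
    (Gdck n d c k).toFinset (fun G hG => (Set.mem_toFinset.1 hG).1)
    (fun G hG => (Set.mem_toFinset.1 hG).1.le_orderedTriangles hk hkd (Set.mem_toFinset.1 hG).2) hne
  rw [Fintype.card_fin] at h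
  refine h.trans (le_of_eq ?_)
  ring

end UpperBound

section LowerBound

open Finset

section Transfer

variable {V W : Type*} {G : SimpleGraph V} {H : SimpleGraph W}

theorem IsDRegular.of_iso {d : ℕ} (hG : IsDRegular G d) (e : G ≃g H) : IsDRegular H d := by
  intro w
  rw [← hG (e.symm w), ← Set.ncard_image_of_injective _ e.injective]
  congr 1
  ext x
  simp only [SimpleGraph.mem_neighborSet, Set.mem_image]
  constructor
  · intro h
    exact ⟨e.symm x, e.symm.map_adj_iff.2 h, e.apply_symm_apply x⟩
  · rintro ⟨v, hv, rfl⟩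
    simpa using e.map_adj_iff.2 hv

theorem cliqueCount_le_of_embedding [Finite W] (f : G ↪g H) (k : ℕ) :
    cliqueCount G k ≤ cliqueCount H k := by
  classical
  refine Nat.card_le_card_of_injective
    (fun t : {t : Finset V // G.IsNClique k t} =>
      (⟨t.1.map f.toEmbedding, ?_⟩ : {t : Finset W // H.IsNClique k t})) ?_
  · refine ⟨?_, by rw [card_map, t.2.card_eq]⟩
    intro x hx y hy hxy
    simp only [coe_map, Set.mem_image] at hx hy
    obtain ⟨v, hv, rfl⟩ := hx
    obtain ⟨w, hw, rfl⟩ := hy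
    exact f.map_adj_iff.2 (t.2.isClique hv hw fun h => hxy (by rw [h]))
  · intro s t h
    exact Subtype.ext (map_injective _ (congrArg Subtype.val h))

theorem IsDRegular.sum {d : ℕ} (hG : IsDRegular G d) (hH : IsDRegular H d) :
    IsDRegular (G ⊕g H) d := by
  rintro (v | w)
  · rw [← hG v, ← Set.ncard_image_of_injective (G.neighborSet v) (Sum.inl_injective (β := W))]
    refine congrArg Set.ncard ?_
    ext (x | x) <;> simp
  · rw [← hH w, ← Set.ncard_image_of_injective (H.neighborSet w) (Sum.inr_injective (α := V))]
    refine congrArg Set.ncard ?_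
    ext (x | x) <;> simp

end Transfer

/-- A family of `d`-regular graphs with many cliques on any `n`-element vertex type bounds the size
of `Gdck` from below. -/
theorem card_le_card_Gdck {V P : Type*} [Finite V] {n d k : ℕ} {c : ℝ} (hV : Nat.card V = n)
    (F : P → SimpleGraph V) (hF : Function.Injective F) (hreg : ∀ p, IsDRegular (F p) d)
    (hclique : ∀ p, c * ((d.choose (k - 1) : ℝ) * n / k) ≤ cliqueCount (F p) k) :
    Nat.card P ≤ Nat.card (Gdck n d c k) := by
  let e : V ≃ Fin n := Finite.equivFinOfCardEq hV
  have hiso : ∀ p, F p ≃g (F p).comap e.symm := fun p =>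
    (SimpleGraph.Iso.comap e.symm (F p)).symm
  refine Nat.card_le_card_of_injective
    (fun p => (⟨(F p).comap e.symm, (hreg p).of_iso (hiso p), (hclique p).trans ?_⟩ :
      Gdck n d c k)) ?_
  · exact_mod_cast cliqueCount_le_of_embedding (hiso p).toEmbedding k
  · intro p q h
    have hcomap : (F p).comap e.symm = (F q).comap e.symm := congrArg Subtype.val h
    refine hF ?_
    ext v w
    simpa using congrArg (fun G => G.Adj (e v) (e w)) hcomap

section Circulant

theorem exists_symmetric_finset_card {r d : ℕ} (hdr : d < r) (heven : Even (r * d)) :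
    ∃ T : Finset ℕ, #T = d ∧ T ⊆ Ioo 0 r ∧ ∀ x ∈ T, r - x ∈ T := by
  rcases Nat.even_or_odd d with hd | hd
  · obtain ⟨h, rfl⟩ := hd
    refine ⟨Icc 1 h ∪ Ico (r - h) r, ?_, ?_, ?_⟩
    · rw [card_union_of_disjoint, Nat.card_Icc, Nat.card_Ico]
      · omega
      · refine disjoint_left.2 fun x hx hx' => ?_
        simp only [mem_Icc, mem_Ico] at hx hx'
        omega
    · intro x hx
      simp only [mem_union, mem_Icc, mem_Ico, mem_Ioo] at hx ⊢
      omega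
    · intro x hx
      simp only [mem_union, mem_Icc, mem_Ico] at hx ⊢
      omega
  · have hr : Even r := by
      rcases Nat.even_mul.1 heven with h | h
      · exact h
      · exact absurd h (Nat.not_even_iff_odd.2 hd)
    obtain ⟨s, rfl⟩ := hr
    obtain ⟨t, rfl⟩ := hd
    refine ⟨Icc (s - t) (s + t), ?_, ?_, ?_⟩
    · rw [Nat.card_Icc]
      omega
    · intro x hx
      simp only [mem_Icc, mem_Ioo] at hx ⊢
      omega
    · intro x hx
      simp only [mem_Icc] at hx ⊢
      omega

theorem exists_isDRegular {r d : ℕ} (hdr : d < r) (heven : Even (r * d)) :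
    ∃ G : SimpleGraph (ZMod r), IsDRegular G d := by
  obtain ⟨T, hcard, hsub, hsymm⟩ := exists_symmetric_finset_card hdr heven
  have : NeZero r := ⟨by omega⟩
  have hneg : ∀ x : ZMod r, x.val ∈ T → (-x).val ∈ T := by
    intro x hx
    have hx0 : x ≠ 0 := by
      rintro rfl
      have := hsub hx
      simp at this
    rw [ZMod.neg_val, if_neg hx0]
    exact hsymm _ hx
  refine ⟨⟨fun u v => (v - u).val ∈ T, ⟨fun u v h => ?_⟩, ⟨fun u h => ?_⟩⟩, fun u => ?_⟩
  · simpa using hneg _ h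
  · have := hsub h
    simp at this
  · rw [← hcard, ← Set.ncard_coe_finset]
    refine Set.ncard_congr (fun v _ => (v - u).val) (fun v hv => hv) ?_ ?_
    · intro v w _ _ h
      exact sub_left_injective (ZMod.val_injective r h)
    · intro t ht
      have htr := hsub ht
      rw [mem_Ioo] at htr
      have hval : ((t : ZMod r)).val = t := ZMod.val_cast_of_lt htr.2
      refine ⟨(t : ZMod r) + u, ?_, ?_⟩
      · change ((t : ZMod r) + u - u).val ∈ T
        rw [add_sub_cancel_right, hval]
        exact ht
      · simp [hval]

end Circulant

section Lift

variable {q d : ℕ}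

/-- A graph whose vertices fall into `d + 1` fibres is `d`-regular if each vertex has a unique
neighbour in every other fibre and none in its own. -/
theorem isDRegular_of_existsUnique {α : Type*} {G : SimpleGraph (Fin (d + 1) × α)}
    (hfibre : ∀ i x y, ¬ G.Adj (i, x) (i, y))
    (hunique : ∀ i x j, i ≠ j → ∃! y, G.Adj (i, x) (j, y)) : IsDRegular G d := by
  rintro ⟨i, x⟩
  have hcard : (↑({i}ᶜ : Finset (Fin (d + 1))) : Set (Fin (d + 1))).ncard = d := by
    rw [Set.ncard_coe_finset, card_compl, card_singleton, Fintype.card_fin, Nat.add_sub_cancel]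
  refine Eq.trans ?_ hcard
  refine Set.ncard_congr (fun p _ => p.1) ?_ ?_ ?_
  · rintro ⟨j, y⟩ hy
    simp only [coe_compl, coe_singleton, Set.mem_compl_iff, Set.mem_singleton_iff]
    rintro rfl
    exact hfibre _ _ _ hy
  · rintro ⟨j, y⟩ ⟨j', z⟩ hy hz h
    obtain rfl : j = j' := h
    have hij : i ≠ j := by
      rintro rfl
      exact hfibre _ _ _ hy
    rw [(hunique i x j hij).unique hy hz]
  · intro j hj
    have hij : i ≠ j := by
      rintro rfl
      simp at hj
    obtain ⟨y, hy, -⟩ := hunique i x j hij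
    exact ⟨(j, y), hy, rfl⟩

/-- The lift of the complete graph on `d + 1` vertices in which the edge between `i < j` is replaced
by the perfect matching `τ`. -/
def liftGraph (τ : {e : Sym2 (Fin (d + 1)) // ¬ e.IsDiag} → Equiv.Perm (Fin q)) :
    SimpleGraph (Fin (d + 1) × Fin q) where
  Adj p p' :=
    (∃ h : p.1 < p'.1, p'.2 = τ ⟨s(p.1, p'.1), by simpa using h.ne⟩ p.2) ∨
      ∃ h : p'.1 < p.1, p.2 = τ ⟨s(p'.1, p.1), by simpa using h.ne⟩ p'.2
  symm := ⟨fun _ _ h => h.symm⟩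
  loopless := ⟨by rintro p (⟨h, -⟩ | ⟨h, -⟩) <;> exact lt_irrefl _ h⟩

theorem isDRegular_liftGraph (τ : {e : Sym2 (Fin (d + 1)) // ¬ e.IsDiag} → Equiv.Perm (Fin q)) :
    IsDRegular (liftGraph τ) d := by
  refine isDRegular_of_existsUnique (fun i x y h => ?_) fun i x j hij => ?_
  · rcases h with ⟨h, -⟩ | ⟨h, -⟩ <;> exact lt_irrefl _ h
  · rcases hij.lt_or_gt with h | h
    · refine ⟨τ ⟨s(i, j), by simpa using h.ne⟩ x, Or.inl ⟨h, rfl⟩, ?_⟩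
      rintro y (⟨_, hy⟩ | ⟨h', -⟩)
      · exact hy
      · exact absurd h h'.asymm
    · refine ⟨(τ ⟨s(j, i), by simpa using h.ne⟩).symm x, Or.inr ⟨h, by simp⟩, ?_⟩
      rintro y (⟨h', -⟩ | ⟨_, hy⟩)
      · exact absurd h h'.asymm
      · exact ((Equiv.symm_apply_eq _).2 hy).symm

theorem liftGraph_injective : Function.Injective (liftGraph (q := q) (d := d)) := by
  have key : ∀ (τ τ' : {e : Sym2 (Fin (d + 1)) // ¬ e.IsDiag} → Equiv.Perm (Fin q)),
      liftGraph τ = liftGraph τ' → ∀ i j (h : i < j),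
        τ ⟨s(i, j), by simpa using h.ne⟩ = τ' ⟨s(i, j), by simpa using h.ne⟩ := by
    intro τ τ' heq i j h
    ext1 x
    have hadj : (liftGraph τ).Adj (i, x) (j, τ ⟨s(i, j), by simpa using h.ne⟩ x) :=
      Or.inl ⟨h, rfl⟩
    rw [heq] at hadj
    rcases hadj with ⟨_, hy⟩ | ⟨h', -⟩
    · exact hy
    · exact absurd h h'.asymm
  intro τ τ' heq
  ext1 ⟨e, he⟩
  induction e with
  | _ i j =>
    have hij : i ≠ j := by simpa using he
    rcases hij.lt_or_gt with h | h
    · exact key τ τ' heq i j h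
    · have := key τ τ' heq j i h
      simpa only [Sym2.eq_swap (a := j) (b := i)] using this

/-- Disjoint copies of the complete graph on `d + 1` vertices, each meeting every fibre once. -/
def cliqueGraph (σ : Fin d → Equiv.Perm (Fin q)) : SimpleGraph (Fin (d + 1) × Fin q) where
  Adj p p' := p.1 ≠ p'.1 ∧
    (Fin.cons 1 σ : Fin (d + 1) → Equiv.Perm (Fin q)) p.1 p.2 =
      (Fin.cons 1 σ : Fin (d + 1) → Equiv.Perm (Fin q)) p'.1 p'.2
  symm := ⟨fun _ _ h => ⟨h.1.symm, h.2.symm⟩⟩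
  loopless := ⟨fun _ h => h.1 rfl⟩

theorem isDRegular_cliqueGraph (σ : Fin d → Equiv.Perm (Fin q)) :
    IsDRegular (cliqueGraph σ) d := by
  refine isDRegular_of_existsUnique (fun i x y h => h.1 rfl) fun i x j hij => ?_
  refine ⟨((Fin.cons 1 σ : Fin (d + 1) → Equiv.Perm (Fin q)) j).symm
    ((Fin.cons 1 σ : Fin (d + 1) → Equiv.Perm (Fin q)) i x), ⟨hij, by simp⟩, fun y hy => ?_⟩
  exact (Equiv.eq_symm_apply _).2 hy.2.symm

theorem cliqueGraph_injective : Function.Injective (cliqueGraph (q := q) (d := d)) := by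
  intro σ σ' heq
  ext1 i
  ext1 x
  have hadj : (cliqueGraph σ).Adj (0, σ i x) (i.succ, x) := by
    simp [cliqueGraph, (Fin.succ_ne_zero i).symm]
  rw [heq] at hadj
  simpa using hadj.2

theorem mul_choose_le_cliqueCount_cliqueGraph (σ : Fin d → Equiv.Perm (Fin q)) {k : ℕ}
    (hk : k ≠ 0) : q * (d + 1).choose k ≤ cliqueCount (cliqueGraph σ) k := by
  classical
  set ρ : Fin (d + 1) → Equiv.Perm (Fin q) := Fin.cons 1 σ with hρ
  let f : Fin q → Fin (d + 1) ↪ Fin (d + 1) × Fin q := fun z =>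
    ⟨fun i => (i, (ρ i).symm z), fun i j h => congrArg Prod.fst h⟩
  have hcard : Nat.card (Fin q × powersetCard k (univ : Finset (Fin (d + 1)))) =
      q * (d + 1).choose k := by
    simp
  rw [← hcard]
  refine Nat.card_le_card_of_injective
    (fun p => (⟨p.2.1.map (f p.1), ?_⟩ :
      {t : Finset (Fin (d + 1) × Fin q) // (cliqueGraph σ).IsNClique k t})) ?_
  · refine ⟨?_, by rw [card_map, (mem_powersetCard.1 p.2.2).2]⟩
    intro a ha b hb hab
    simp only [coe_map, Set.mem_image] at ha hb
    obtain ⟨i, -, rfl⟩ := ha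
    obtain ⟨j, -, rfl⟩ := hb
    refine ⟨fun h => hab (congrArg (f p.1) h), ?_⟩
    change ρ i ((ρ i).symm p.1) = ρ j ((ρ j).symm p.1)
    simp
  · rintro ⟨z, S, hS⟩ ⟨z', S', hS'⟩ h
    have h : S.map (f z) = S'.map (f z') := congrArg Subtype.val h
    have hfst : ∀ (z : Fin q) (S : Finset (Fin (d + 1))), (S.map (f z)).image Prod.fst = S := by
      intro z S
      rw [map_eq_image, image_image]
      exact image_id
    obtain rfl : S = S' := by rw [← hfst z S, h, hfst]
    obtain ⟨i, hi⟩ : S.Nonempty := by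
      rw [← card_pos, (mem_powersetCard.1 hS).2]
      omega
    have hmem : f z i ∈ S.map (f z') := h ▸ mem_map_of_mem _ hi
    obtain ⟨j, -, hj⟩ := mem_map.1 hmem
    obtain rfl : j = i := congrArg Prod.fst hj
    have hz : z' = z := (ρ j).symm.injective (congrArg Prod.snd hj)
    rw [hz]

end Lift

/-- Disjoint cliques next to a lift of a complete graph and a fixed regular graph on the few
remaining vertices. -/
theorem factorial_pow_mul_factorial_pow_le_card_Gdck {n d k m l r : ℕ} {c : ℝ} (hk : 1 ≤ k)
    (hn : (d + 1) * m + (d + 1) * l + r = n) (hdr : d < r) (heven : Even (n * d))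
    (hm : c * n ≤ (d + 1) * m) :
    m.factorial ^ d * l.factorial ^ (d + 1).choose 2 ≤ Nat.card (Gdck n d c k) := by
  have heven' : Even (r * d) := by
    have hprod : n * d = d * (d + 1) * (m + l) + r * d := by
      rw [← hn]
      ring
    rw [hprod] at heven
    exact (Nat.even_add.1 heven).1 ((Nat.even_mul_succ_self d).mul_right _)
  obtain ⟨H, hH⟩ := exists_isDRegular hdr heven'
  have : NeZero r := ⟨by omega⟩
  have hV : Nat.card ((Fin (d + 1) × Fin m) ⊕ ((Fin (d + 1) × Fin l) ⊕ ZMod r)) = n := by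
    rw [← hn]
    simp [add_assoc]
  let F : (Fin d → Equiv.Perm (Fin m)) ×
      ({e : Sym2 (Fin (d + 1)) // ¬ e.IsDiag} → Equiv.Perm (Fin l)) →
      SimpleGraph ((Fin (d + 1) × Fin m) ⊕ ((Fin (d + 1) × Fin l) ⊕ ZMod r)) :=
    fun p => cliqueGraph p.1 ⊕g (liftGraph p.2 ⊕g H)
  have hF : Function.Injective F := by
    rintro ⟨σ, τ⟩ ⟨σ', τ'⟩ h
    have h1 : cliqueGraph σ = cliqueGraph σ' := by
      ext x y
      have := congrArg (fun G => G.Adj (Sum.inl x) (Sum.inl y)) h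
      simpa [F] using this
    have h2 : liftGraph τ = liftGraph τ' := by
      ext x y
      have := congrArg (fun G => G.Adj (Sum.inr (Sum.inl x)) (Sum.inr (Sum.inl y))) h
      simpa [F] using this
    rw [cliqueGraph_injective h1, liftGraph_injective h2]
  have hcard := card_le_card_Gdck (c := c) (k := k) hV F hF
    (fun p => (isDRegular_cliqueGraph p.1).sum ((isDRegular_liftGraph p.2).sum hH)) fun p => ?_
  · refine le_of_eq_of_le ?_ hcard
    rw [Nat.card_prod, Nat.card_fun, Nat.card_fun, Nat.card_perm, Nat.card_perm,
      Nat.card_eq_fintype_card (α := {e : Sym2 (Fin (d + 1)) // ¬ e.IsDiag}),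
      Sym2.card_subtype_not_diag]
    simp
  · have h1 : (m * (d + 1).choose k : ℕ) ≤ cliqueCount (F p) k :=
      (mul_choose_le_cliqueCount_cliqueGraph p.1 (by omega)).trans
        (cliqueCount_le_of_embedding SimpleGraph.Embedding.sumInl k)
    have h2 : ((m : ℝ) * (d + 1).choose k) ≤ cliqueCount (F p) k := by exact_mod_cast h1
    refine le_trans ?_ h2
    obtain ⟨j, rfl⟩ := Nat.exists_eq_add_of_le' hk
    have h3 : ((d : ℝ) + 1) * d.choose j = (d + 1).choose (j + 1) * (j + 1) := by
      exact_mod_cast Nat.add_one_mul_choose_eq d j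
    rw [Nat.add_sub_cancel]
    push_cast
    rw [← mul_div_assoc, div_le_iff₀ (by positivity)]
    have h4 := mul_le_mul_of_nonneg_right hm (show (0 : ℝ) ≤ d.choose j by positivity)
    linear_combination h4 + m * h3

theorem mul_log_sub_le_log_factorial (q : ℕ) : q * Real.log q - q ≤ Real.log q.factorial := by
  rcases eq_or_ne q 0 with rfl | hq
  · simp
  have h1 := Stirling.le_log_factorial_stirling hq
  have h2 := Real.log_natCast_nonneg q
  have h3 : 0 ≤ Real.log (2 * Real.pi) := Real.log_nonneg (by linarith [Real.pi_gt_three])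
  linarith

theorem le_mul_log_factorial {n q : ℕ} {b : ℝ} (hb : 1 ≤ b) (hn : b * q ≤ n) :
    b * q * Real.log n - n * (1 + Real.log b) ≤ b * Real.log q.factorial := by
  have hlogb : 0 ≤ Real.log b := Real.log_nonneg hb
  rcases Nat.eq_zero_or_pos q with rfl | hq
  · simp only [Nat.cast_zero, mul_zero, zero_mul, zero_sub, Nat.factorial_zero, Nat.cast_one,
      Real.log_one, Left.neg_nonpos_iff]
    positivity
  have hq0 : (0 : ℝ) < q := by exact_mod_cast hq
  have hb0 : 0 < b := by linarith
  have hbq : 0 < b * q := by positivity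
  have hn0 : (0 : ℝ) < n := by linarith
  have h1 := mul_le_mul_of_nonneg_left (mul_log_sub_le_log_factorial q) hb0.le
  have h2 : Real.log n - Real.log (b * q) ≤ n / (b * q) - 1 := by
    rw [← Real.log_div hn0.ne' hbq.ne']
    exact Real.log_le_sub_one_of_pos (by positivity)
  have h3 : b * q * (Real.log n - Real.log (b * q)) ≤ n - b * q := by
    calc b * q * (Real.log n - Real.log (b * q)) ≤ b * q * (n / (b * q) - 1) := by gcongr
      _ = n - b * q := by field_simp
  rw [Real.log_mul hb0.ne' hq0.ne'] at h3
  have h4 : b * q * Real.log b ≤ n * Real.log b := by gcongr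
  linarith

theorem le_log_card_Gdck {n d k : ℕ} {c : ℝ} (hk : 1 ≤ k) (hc0 : 0 ≤ c) (hd : 1 ≤ d)
    (hdn : d ^ 2 ≤ n) (heven : Even (n * d)) (hroom : 2 * ((d : ℝ) + 1) ≤ (1 - c) * n) :
    (1 - c * ((d : ℝ) - 1) / ((d : ℝ) + 1)) * ((d : ℝ) * n / 2) * Real.log n -
      9 * d * n * (1 + Real.log d) ≤ Real.log (Nat.card (Gdck n d c k)) := by
  have hd1 : (1 : ℝ) ≤ d := by exact_mod_cast hd
  have hdn' : (d : ℝ) ^ 2 ≤ n := by exact_mod_cast hdn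
  have hb : (1 : ℝ) ≤ (d : ℝ) + 1 := by linarith
  set m := ⌈c * n / (d + 1)⌉₊ with hm
  have hm1 : c * n ≤ (d + 1) * m := by
    have := Nat.le_ceil (c * n / (d + 1))
    rwa [div_le_iff₀' (by positivity)] at this
  have hm2 : ((d : ℝ) + 1) * m < c * n + (d + 1) := by
    have := Nat.ceil_lt_add_one (show 0 ≤ c * n / (d + 1) by positivity)
    rw [← hm, ← sub_lt_iff_lt_add, lt_div_iff₀ (by positivity)] at this
    linarith
  have hmn : (d + 1) * m + (d + 1) ≤ n := by
    have : ((d : ℝ) + 1) * m + (d + 1) ≤ n := by linarith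
    exact_mod_cast this
  obtain ⟨n₁, hn₁⟩ := Nat.exists_eq_add_of_le (le_of_add_le_left hmn)
  obtain ⟨l, hl⟩ : ∃ l, n₁ / (d + 1) = l + 1 := Nat.exists_eq_add_of_le'
    ((Nat.one_le_div_iff (by omega)).2 (by omega))
  have hdiv : n₁ = (d + 1) * l + (d + 1 + n₁ % (d + 1)) := by
    have := Nat.div_add_mod n₁ (d + 1)
    rw [hl, mul_add, mul_one] at this
    omega
  have hmod : n₁ % (d + 1) < d + 1 := Nat.mod_lt _ (by omega)
  set r := d + 1 + n₁ % (d + 1) with hr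
  have hsum : (d + 1) * m + (d + 1) * l + r = n := by omega
  have hcard := factorial_pow_mul_factorial_pow_le_card_Gdck hk hsum (by omega) heven hm1
  have hsum' : ((d : ℝ) + 1) * m + (d + 1) * l + r = n := by exact_mod_cast hsum
  have hr' : (r : ℝ) ≤ 2 * (d + 1) := by
    exact_mod_cast (show r ≤ 2 * (d + 1) by omega)
  have hr0 : (0 : ℝ) ≤ r := by positivity
  have hlog : d * Real.log m.factorial + (d + 1) * d / 2 * Real.log l.factorial ≤
      Real.log (Nat.card (Gdck n d c k)) := by
    have hpos : (0 : ℝ) < (m.factorial : ℝ) ^ d * (l.factorial : ℝ) ^ (d + 1).choose 2 := by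
      positivity
    have hcard' : (m.factorial : ℝ) ^ d * (l.factorial : ℝ) ^ (d + 1).choose 2 ≤
        (Nat.card (Gdck n d c k) : ℝ) := by exact_mod_cast hcard
    have h := Real.log_le_log hpos hcard'
    rw [Real.log_mul (by positivity) (by positivity), Real.log_pow, Real.log_pow,
      Nat.cast_choose_two] at h
    push_cast at h
    rwa [add_sub_cancel_right] at h
  set L := Real.log n with hL
  have hL0 : 0 ≤ L := Real.log_natCast_nonneg n
  have hlogd : 0 ≤ Real.log d := Real.log_natCast_nonneg d
  set E : ℝ := n * (1 + Real.log (d + 1)) with hE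
  have hm3 : (d + 1) * m * L - E ≤ (d + 1) * Real.log m.factorial :=
    le_mul_log_factorial hb (by linarith [mul_nonneg (zero_le_one.trans hb) (Nat.cast_nonneg l)])
  have hl3 : (d + 1) * l * L - E ≤ (d + 1) * Real.log l.factorial :=
    le_mul_log_factorial hb (by linarith [mul_nonneg (zero_le_one.trans hb) (Nat.cast_nonneg m)])
  have hE' : E ≤ n * (2 + Real.log d) := by
    have h1 : Real.log (d + 1) - Real.log d ≤ 1 := by
      rw [← Real.log_div (by positivity) (by positivity)]
      refine (Real.log_le_sub_one_of_pos (by positivity)).trans ?_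
      rw [sub_le_iff_le_add, div_le_iff₀ (by positivity)]
      linarith
    exact mul_le_mul_of_nonneg_left (by linarith) (Nat.cast_nonneg n)
  have hdL : ((d : ℝ) + 1) * L ≤ 4 * n := by
    have hs : Real.sqrt n ^ 2 = n := Real.sq_sqrt (by positivity)
    have hds : (d : ℝ) ≤ Real.sqrt n := Real.le_sqrt_of_sq_le hdn'
    have hLs : L ≤ 2 * Real.sqrt n := by
      have h1 : (1 : ℝ) ≤ Real.sqrt n := hd1.trans hds
      have h2 := Real.log_le_sub_one_of_pos (show 0 < Real.sqrt n by linarith)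
      have h3 : Real.log n = 2 * Real.log (Real.sqrt n) := by
        rw [Real.log_sqrt (by positivity)]
        ring
      rw [hL, h3]
      linarith
    calc ((d : ℝ) + 1) * L ≤ (2 * Real.sqrt n) * (2 * Real.sqrt n) := by
          gcongr
          linarith
      _ = 4 * n := by linear_combination 4 * hs
  have hml : (c * n) * L ≤ (d + 1) * m * L := by gcongr
  have hll : ((1 - c) * n - 3 * (d + 1)) * L ≤ (d + 1) * l * L := by
    gcongr
    linarith
  have hfrac : (d : ℝ) / (d + 1) * (c * n * L - E) ≤ d * Real.log m.factorial := by
    rw [div_mul_eq_mul_div, div_le_iff₀ (by positivity)]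
    have := mul_le_mul_of_nonneg_left (hm3.trans' (sub_le_sub_right hml E))
      (show (0 : ℝ) ≤ d by positivity)
    linarith
  have hhalf : (d : ℝ) / 2 * (((1 - c) * n - 3 * (d + 1)) * L - E) ≤
      (d + 1) * d / 2 * Real.log l.factorial := by
    have := mul_le_mul_of_nonneg_left (hl3.trans' (sub_le_sub_right hll E))
      (show (0 : ℝ) ≤ d / 2 by positivity)
    linarith
  have hE0 : 0 ≤ E := mul_nonneg (by positivity) (by linarith [Real.log_nonneg hb])
  have herr : (d : ℝ) / (d + 1) * E ≤ d * E := by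
    gcongr
    exact div_le_self (by positivity) hb
  have hmain : (1 - c * ((d : ℝ) - 1) / ((d : ℝ) + 1)) * ((d : ℝ) * n / 2) * L =
      (d : ℝ) / (d + 1) * (c * n * L) + d / 2 * ((1 - c) * n * L) := by
    field_simp
    ring
  have hdE := mul_le_mul_of_nonneg_left hE' (show (0 : ℝ) ≤ d by positivity)
  have hddL := mul_le_mul_of_nonneg_left hdL (show (0 : ℝ) ≤ d by positivity)
  have hdnlog : 0 ≤ (d : ℝ) * (n * Real.log d) := by positivity
  rw [hmain]
  linarith

end LowerBound

/-- Counting regular graphs with many `k`-cliques: for fixed `k ≥ 3` and `c ∈ (0,1)` there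
is `C > 0` so that for all `n, d` with `k-1 ≤ d`, `d² ≤ n`, `n*d` even and
`d + 2 ≤ (1-c)n`:
`| log|G_{d,c,k}(n)| - (1 - c(d-1)/(d+1)) (dn/2) log n | ≤ C d n (1 + log d)`. -/
theorem k_clique_counting (k : ℕ) (hk : 3 ≤ k) (c : ℝ) (hc0 : 0 < c) (hc1 : c < 1) :
    ∃ C : ℝ, 0 < C ∧ ∀ n d : ℕ, k - 1 ≤ d → d ^ 2 ≤ n → Even (n * d) →
      (d : ℝ) + 2 ≤ (1 - c) * n →
      |Real.log (Nat.card (Gdck n d c k)) -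
          (1 - c * ((d : ℝ) - 1) / ((d : ℝ) + 1)) * ((d : ℝ) * n / 2) * Real.log n|
        ≤ C * d * n * (1 + Real.log d) := by
  have hc : 0 < 1 - c := sub_pos.2 hc1
  refine ⟨9 + 9 / (1 - c) ^ 2, by positivity, fun n d hkd hdn heven _ => ?_⟩
  have hd2 : (2 : ℝ) ≤ d := by exact_mod_cast (show 2 ≤ d by omega)
  have hdn' : (d : ℝ) ^ 2 ≤ n := by exact_mod_cast hdn
  have hlogd : 0 ≤ Real.log d := Real.log_natCast_nonneg d
  have hX : 0 ≤ 9 / (1 - c) ^ 2 * ((d : ℝ) * n * (1 + Real.log d)) := by positivity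
  have hdn0 : 0 ≤ (d : ℝ) * n := by positivity
  have hdnlog : 0 ≤ (d : ℝ) * n * Real.log d := by positivity
  rw [abs_le]
  constructor
  · rcases le_or_gt (2 * ((d : ℝ) + 1)) ((1 - c) * n) with hroom | hsmall
    · have := le_log_card_Gdck (k := k) (by omega) hc0.le (by omega) hdn heven hroom
      linarith
    · have hn0 : (0 : ℝ) < n := by nlinarith
      have hn : (1 - c) * n ≤ 3 * d := by linarith
      have hd3 : (1 - c) * d ≤ 3 := by
        refine le_of_mul_le_mul_right ?_ (show (0 : ℝ) < d by linarith)
        calc (1 - c) * d * d = (1 - c) * d ^ 2 := by ring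
          _ ≤ (1 - c) * n := by gcongr
          _ ≤ 3 * d := hn
      have hnN : (n : ℝ) ≤ 9 / (1 - c) ^ 2 := by
        rw [le_div_iff₀ (by positivity)]
        calc (n : ℝ) * (1 - c) ^ 2 = (1 - c) * ((1 - c) * n) := by ring
          _ ≤ (1 - c) * (3 * d) := by gcongr
          _ = 3 * ((1 - c) * d) := by ring
          _ ≤ 9 := by linarith
      have hlogn : Real.log n ≤ 9 / (1 - c) ^ 2 := by
        linarith [Real.log_le_sub_one_of_pos hn0]
      have hcard := Real.log_natCast_nonneg (Nat.card (Gdck n d c k))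
      have hcoef : 1 - c * ((d : ℝ) - 1) / ((d : ℝ) + 1) ≤ 1 := by
        have : 0 ≤ c * ((d : ℝ) - 1) / ((d : ℝ) + 1) :=
          div_nonneg (mul_nonneg hc0.le (by linarith)) (by linarith)
        linarith
      have hmain : (1 - c * ((d : ℝ) - 1) / ((d : ℝ) + 1)) * ((d : ℝ) * n / 2) * Real.log n ≤
          1 * ((d : ℝ) * n / 2) * (9 / (1 - c) ^ 2) := by
        gcongr
      have hY : 0 ≤ 9 / (1 - c) ^ 2 * ((d : ℝ) * n) := by positivity
      have hZ : 0 ≤ 9 / (1 - c) ^ 2 * ((d : ℝ) * n * Real.log d) := by positivity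
      linarith
  · have hup := log_card_Gdck_le (n := n) hk hc1.le hkd
    have hlog : Real.log ((d : ℝ) ^ 2 + 1) ≤ 3 * Real.log d := by
      have h : 3 * Real.log (d : ℝ) = Real.log ((d : ℝ) ^ 3) := by
        rw [Real.log_pow]
        norm_num
      rw [h]
      exact Real.log_le_log (by positivity) (by nlinarith [sq_nonneg (d : ℝ)])
    have h1 : (n : ℝ) * (d * Real.log ((d : ℝ) ^ 2 + 1) + 1) ≤
        n * (d * (3 * Real.log d) + d) := by
      gcongr
      linarith
    linarith
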